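/- Let $\alpha>0$ and $E\subset\mathbb{R}^n$ be nonempty. Then $\operatorname{dist}(\cdot,E)^{-\alpha}\in A_1$ if and only if $\Mu(E)>\alpha$. -/

import Mathlib

open MeasureTheory Metric Set

noncomputable section

/-- An axis-parallel half-open cube in `ℝⁿ`, given by its lower corner and side length. -/
structure Cube (n : ℕ) where
  a : EuclideanSpace ℝ (Fin n)
  l : ℝ
  pos : 0 < l

/-- The set of points of a cube. -/
def Cube.set {n : ℕ} (P : Cube n) : Set (EuclideanSpace ℝ (Fin n)) :=
  {x | ∀ i, P.a i ≤ x i ∧ x i < P.a i + P.l}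

/-- A weight: locally integrable and a.e. positive. -/
def IsWeight {n : ℕ} (w : EuclideanSpace ℝ (Fin n) → ℝ) : Prop :=
  LocallyIntegrable w volume ∧ ∀ᵐ x ∂(volume : Measure (EuclideanSpace ℝ (Fin n))), 0 < w x

/-- The `A₁` inequality with constant `C`, over all axis-parallel cubes. -/
def A1With {n : ℕ} (w : EuclideanSpace ℝ (Fin n) → ℝ) (C : ℝ) : Prop :=
  ∀ P : Cube n, (⨍ x in P.set, w x) ≤ C * essInf w (volume.restrict P.set)

/-- Membership in the Muckenhoupt class `A₁`. -/
def MemA1 {n : ℕ} (w : EuclideanSpace ℝ (Fin n) → ℝ) : Prop :=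
  IsWeight w ∧ ∃ C : ℝ, A1With w C

/-- The `A_p` inequality with constant `C`, over all axis-parallel cubes. -/
def ApWith {n : ℕ} (w : EuclideanSpace ℝ (Fin n) → ℝ) (p C : ℝ) : Prop :=
  ∀ P : Cube n,
    (⨍ x in P.set, w x) * (⨍ x in P.set, w x ^ (1 / (1 - p))) ^ (p - 1) ≤ C

/-- Membership in the Muckenhoupt class `A_p`. -/
def MemAp {n : ℕ} (w : EuclideanSpace ℝ (Fin n) → ℝ) (p : ℝ) : Prop :=
  IsWeight w ∧ ∃ C : ℝ, ApWith w p C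

/-- `Q` is a dyadic subcube of `P`. -/
def IsDyadicSubcube {n : ℕ} (P Q : Cube n) : Prop :=
  ∃ (j : ℕ) (k : Fin n → ℕ), (∀ i, k i < 2 ^ j) ∧
    Q.l = P.l / 2 ^ j ∧ ∀ i, Q.a i = P.a i + P.l * k i / 2 ^ j

/-- A cube is `E`-free if it does not meet `E`. -/
def EFree {n : ℕ} (E : Set (EuclideanSpace ℝ (Fin n))) (Q : Cube n) : Prop :=
  Q.set ∩ E = ∅

/-- The measure `|𝓜(P)|` of a largest `E`-free dyadic subcube of `P`
(`0` if there is none). -/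
def maxFree {n : ℕ} (E : Set (EuclideanSpace ℝ (Fin n))) (P : Cube n) : ℝ :=
  sSup {v : ℝ | ∃ Q : Cube n, IsDyadicSubcube P Q ∧ EFree E Q ∧ v = (volume Q.set).toReal}

/-- Weak porosity with constants `c`, `δ`. -/
def WeaklyPorousWith {n : ℕ} (E : Set (EuclideanSpace ℝ (Fin n))) (c δ : ℝ) : Prop :=
  ∀ P : Cube n, ∃ (N : ℕ) (Q : Fin N → Cube n),
    (∀ k, IsDyadicSubcube P (Q k) ∧ EFree E (Q k)) ∧
    (∀ k m, k ≠ m → Disjoint (Q k).set (Q m).set) ∧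
    (∀ k, δ * maxFree E P ≤ (volume (Q k).set).toReal) ∧
    c * (volume P.set).toReal ≤ ∑ k, (volume (Q k).set).toReal

/-- A set is weakly porous if it is weakly porous with some constants `0 < c, δ < 1`. -/
def WeaklyPorous {n : ℕ} (E : Set (EuclideanSpace ℝ (Fin n))) : Prop :=
  ∃ c δ : ℝ, 0 < c ∧ c < 1 ∧ 0 < δ ∧ δ < 1 ∧ WeaklyPorousWith E c δ

/-- Porosity. -/
def Porous {n : ℕ} (E : Set (EuclideanSpace ℝ (Fin n))) : Prop :=
  ∃ c : ℝ, 0 < c ∧ ∀ (x : EuclideanSpace ℝ (Fin n)) (r : ℝ), 0 < r →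
    ∃ y : EuclideanSpace ℝ (Fin n), ball y (c * r) ⊆ ball x r \ E

/-- The distance weight `dist(·,E)^{-α}`. -/
def distw {n : ℕ} (E : Set (EuclideanSpace ℝ (Fin n))) (α : ℝ)
    (x : EuclideanSpace ℝ (Fin n)) : ℝ :=
  infDist x E ^ (-α)

/-- `h_E(B(x,R))`: the supremum of radii `t` of balls contained in `B(x,R) \ E`. -/
def hFree {n : ℕ} (E : Set (EuclideanSpace ℝ (Fin n))) (x : EuclideanSpace ℝ (Fin n))
    (R : ℝ) : ℝ :=
  sSup {t : ℝ | ∃ y ∈ ball x R, ball y t ⊆ ball x R \ E}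

/-- The set of admissible exponents in the definition of the Muckenhoupt exponent. -/
def MuckSet {n : ℕ} (E : Set (EuclideanSpace ℝ (Fin n))) : Set ℝ :=
  {α : ℝ | ∃ C : ℝ, ∀ x ∈ E, ∀ R r : ℝ, 0 < r → r < hFree E x R → hFree E x R ≤ R →
    (volume (thickening r E ∩ ball x R)).toReal ≤
      C * (hFree E x R / r) ^ (-α) * (volume (ball x R)).toReal}

open scoped Classical in
/-- The Muckenhoupt exponent of `E`. -/
def MuckExp {n : ℕ} (E : Set (EuclideanSpace ℝ (Fin n))) : ℝ :=
  if ∀ x ∈ E, ∀ R : ℝ, 0 < R → 0 < hFree E x R then sSup (MuckSet E) else 0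

end

section

variable {n : ℕ} {E : Set (EuclideanSpace ℝ (Fin n))} {α : ℝ}

lemma Cube.set_eq_preimage (P : Cube n) :
    P.set = (WithLp.ofLp : EuclideanSpace ℝ (Fin n) → Fin n → ℝ) ⁻¹'
      (univ.pi fun i => Ico (P.a i) (P.a i + P.l)) := by
  ext x
  simp [Cube.set]

lemma Cube.measurableSet (P : Cube n) : MeasurableSet P.set := by
  rw [P.set_eq_preimage]
  exact (PiLp.volume_preserving_ofLp (Fin n)).measurable
    (MeasurableSet.univ_pi fun _ => measurableSet_Ico)

lemma Cube.volume_set (P : Cube n) : volume P.set = ENNReal.ofReal (P.l ^ n) := by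
  rw [P.set_eq_preimage, (PiLp.volume_preserving_ofLp (Fin n)).measure_preimage
    (MeasurableSet.univ_pi fun _ => measurableSet_Ico).nullMeasurableSet, Real.volume_pi_Ico]
  simp [ENNReal.ofReal_pow P.pos.le]

lemma Cube.volume_real_set (P : Cube n) : (volume P.set).toReal = P.l ^ n := by
  rw [P.volume_set, ENNReal.toReal_ofReal (pow_nonneg P.pos.le n)]

lemma Cube.volume_set_ne_top (P : Cube n) : volume P.set ≠ ⊤ := by
  rw [P.volume_set]; exact ENNReal.ofReal_ne_top

lemma Cube.volume_set_ne_zero (P : Cube n) : volume P.set ≠ 0 := by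
  rw [P.volume_set]; simpa using pow_pos P.pos n

lemma Cube.corner_mem (P : Cube n) : P.a ∈ P.set := fun _ => ⟨le_rfl, by linarith [P.pos]⟩

/-- A crude diameter bound which stays positive in dimension zero. -/
lemma Cube.dist_le (P : Cube n) {x y : EuclideanSpace ℝ (Fin n)} (hx : x ∈ P.set)
    (hy : y ∈ P.set) : dist x y ≤ (n + 1) * P.l := by
  have hl := P.pos
  rw [EuclideanSpace.dist_eq]
  refine Real.sqrt_le_iff.2 ⟨by positivity, ?_⟩
  calc ∑ i, dist (x i) (y i) ^ 2 ≤ ∑ _i : Fin n, P.l ^ 2 := by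
        refine Finset.sum_le_sum fun i _ => ?_
        refine pow_le_pow_left₀ dist_nonneg ?_ 2
        rw [Real.dist_eq, abs_le]
        constructor <;> linarith [(hx i).1, (hx i).2, (hy i).1, (hy i).2]
    _ = n * P.l ^ 2 := by simp
    _ ≤ ((n + 1) * P.l) ^ 2 := by
        rw [mul_pow]
        gcongr
        nlinarith [(Nat.cast_nonneg n : (0 : ℝ) ≤ n)]

/-- The cube shrunk by the factor `t` towards the point `y`. -/
noncomputable def Cube.shrink (P : Cube n) (y : EuclideanSpace ℝ (Fin n)) (t : ℝ) (ht : 0 < t) : Cube n where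
  a := WithLp.toLp 2 fun i => y i + t * (P.a i - y i)
  l := t * P.l
  pos := mul_pos ht P.pos

lemma Cube.shrink_subset (P : Cube n) {y : EuclideanSpace ℝ (Fin n)} (hy : y ∈ P.set) {t : ℝ}
    (ht : 0 < t) (ht1 : t ≤ 1) : (P.shrink y t ht).set ⊆ P.set := by
  intro x hx i
  have h := hx i
  simp only [Cube.shrink] at h
  have := hy i
  constructor <;> nlinarith

lemma Cube.mem_shrink (P : Cube n) {y : EuclideanSpace ℝ (Fin n)} (hy : y ∈ P.set) {t : ℝ}
    (ht : 0 < t) : y ∈ (P.shrink y t ht).set := by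
  intro i
  have := hy i
  simp only [Cube.shrink]
  constructor <;> nlinarith

/-- The cube circumscribed about the ball `ball x R`. -/
noncomputable def Cube.circumscribed (x : EuclideanSpace ℝ (Fin n)) (R : ℝ) (hR : 0 < R) : Cube n where
  a := WithLp.toLp 2 fun i => x i - R
  l := 2 * R
  pos := by positivity

lemma Cube.ball_subset_circumscribed (x : EuclideanSpace ℝ (Fin n)) {R : ℝ} (hR : 0 < R) :
    ball x R ⊆ (Cube.circumscribed x R hR).set := by
  intro y hy i
  have h : |y i - x i| < R := by
    have h1 : ‖(y - x) i‖ ≤ ‖y - x‖ := PiLp.norm_apply_le (y - x) i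
    rw [mem_ball, dist_eq_norm] at hy
    exact lt_of_le_of_lt (by simpa using h1) hy
  rw [abs_lt] at h
  simp only [Cube.circumscribed]
  constructor <;> linarith [h.1, h.2]

/-- The dyadic children of a cube. -/
noncomputable def Cube.child (P : Cube n) (k : Fin n → Bool) : Cube n where
  a := WithLp.toLp 2 fun i => P.a i + if k i then P.l / 2 else 0
  l := P.l / 2
  pos := half_pos P.pos

lemma Cube.iUnion_child (P : Cube n) : ⋃ k, (P.child k).set = P.set := by
  have hl := P.pos
  ext x
  simp only [mem_iUnion, Cube.set, Cube.child, mem_ofPred_eq]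
  constructor
  · rintro ⟨k, hk⟩ i
    have := hk i
    split_ifs at this <;> constructor <;> linarith
  · intro hx
    refine ⟨fun i => decide (P.a i + P.l / 2 ≤ x i), fun i => ?_⟩
    have := hx i
    simp only [decide_eq_true_eq]
    split_ifs with h <;> constructor <;> linarith

lemma Cube.pairwise_disjoint_child (P : Cube n) :
    Pairwise (Function.onFun Disjoint fun k => (P.child k).set) := by
  intro k m hkm
  refine Set.disjoint_left.2 fun x hk hm => hkm (funext fun i => ?_)
  have h1 := hk i
  have h2 := hm i
  simp only [Cube.child] at h1 h2
  cases hki : k i <;> cases hmi : m i <;> simp [hki, hmi] at h1 h2 ⊢ <;> linarith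

lemma Cube.measure_inter_eq_sum_child (P : Cube n)
    (ν : Measure (EuclideanSpace ℝ (Fin n))) {S : Set (EuclideanSpace ℝ (Fin n))}
    (hS : MeasurableSet S) : ν (P.set ∩ S) = ∑ k, ν ((P.child k).set ∩ S) := by
  rw [← P.iUnion_child, iUnion_inter, measure_iUnion, tsum_fintype]
  · intro k m hkm
    exact (P.pairwise_disjoint_child hkm).mono inter_subset_left inter_subset_left
  · exact fun k => (P.child k).measurableSet.inter hS

lemma Cube.volume_set_eq_child (P : Cube n) (k : Fin n → Bool) :
    volume P.set = ENNReal.ofReal (2 ^ n) * volume (P.child k).set := by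
  rw [Cube.volume_set, Cube.volume_set, ← ENNReal.ofReal_mul (by positivity), ← mul_pow]
  simp only [Cube.child]
  congr 2
  ring

lemma distw_nonneg (x : EuclideanSpace ℝ (Fin n)) : 0 ≤ distw E α x :=
  Real.rpow_nonneg infDist_nonneg _

lemma measurable_distw : Measurable (distw E α) :=
  measurable_infDist.pow_const (-α)

lemma distw_le_rpow (hα : 0 < α) {x : EuclideanSpace ℝ (Fin n)} {r : ℝ} (hr : 0 < r)
    (h : r ≤ infDist x E) : distw E α x ≤ r ^ (-α) :=
  Real.rpow_le_rpow_of_nonpos hr h (by linarith)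

lemma rpow_le_distw (hα : 0 < α) {x : EuclideanSpace ℝ (Fin n)} {r : ℝ}
    (hx : 0 < infDist x E) (h : infDist x E ≤ r) : r ^ (-α) ≤ distw E α x :=
  Real.rpow_le_rpow_of_nonpos hx h (by linarith)

lemma ae_lower_bound_le (hα : 0 < α) (P : Cube n) {y : EuclideanSpace ℝ (Fin n)}
    (hy : y ∈ P.set) (hd : 0 < infDist y E) {a : ℝ}
    (ha : ∀ᵐ x ∂volume.restrict P.set, a ≤ distw E α x) : a ≤ (infDist y E / 2) ^ (-α) := by
  have hl := P.pos
  have hD : 0 < (n + 1) * P.l := by positivity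
  set t := min 1 (infDist y E / 2 / ((n + 1) * P.l)) with ht_def
  have ht : 0 < t := lt_min one_pos (by positivity)
  set Q := P.shrink y t ht
  have hQ : ∀ᵐ x ∂volume.restrict Q.set, a ≤ distw E α x :=
    ae_restrict_of_ae_restrict_of_subset (P.shrink_subset hy ht (min_le_left _ _)) ha
  have : (ae (volume.restrict Q.set)).NeBot := ae_restrict_neBot.2 Q.volume_set_ne_zero
  obtain ⟨x, hxQ, hx⟩ := ((ae_restrict_mem Q.measurableSet).and hQ).exists
  refine hx.trans (distw_le_rpow hα (by positivity) ?_)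
  have h1 : dist y x ≤ (n + 1) * (t * P.l) := Q.dist_le (P.mem_shrink hy ht) hxQ
  have h2 : t * ((n + 1) * P.l) ≤ infDist y E / 2 := by
    rw [← le_div_iff₀ hD]
    exact min_le_right _ _
  have h3 : infDist y E ≤ infDist x E + dist y x := infDist_le_infDist_add_dist
  linarith

lemma essInf_distw_le (hα : 0 < α) (P : Cube n) {y : EuclideanSpace ℝ (Fin n)}
    (hy : y ∈ P.set) (hd : 0 < infDist y E) :
    essInf (distw E α) (volume.restrict P.set) ≤ (infDist y E / 2) ^ (-α) := by
  rw [essInf, Filter.liminf_eq]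
  refine csSup_le ⟨0, ?_⟩ fun a ha => ae_lower_bound_le hα P hy hd ha
  rw [mem_ofPred_eq]
  exact Filter.Eventually.of_forall fun x => distw_nonneg x

lemma le_essInf_distw (hα : 0 < α) (P : Cube n) {y : EuclideanSpace ℝ (Fin n)}
    (hy : y ∈ P.set) (hd : 0 < infDist y E) {a : ℝ}
    (ha : ∀ᵐ x ∂volume.restrict P.set, a ≤ distw E α x) :
    a ≤ essInf (distw E α) (volume.restrict P.set) := by
  rw [essInf, Filter.liminf_eq]
  exact le_csSup ⟨_, fun b hb => ae_lower_bound_le hα P hy hd hb⟩ ha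

lemma essInf_distw_nonneg (hα : 0 < α) (hpos : ∀ᵐ x ∂(volume : Measure (EuclideanSpace ℝ (Fin n))),
    0 < infDist x E) (P : Cube n) :
    0 ≤ essInf (distw E α) (volume.restrict P.set) := by
  have : (ae (volume.restrict P.set)).NeBot := ae_restrict_neBot.2 P.volume_set_ne_zero
  obtain ⟨y, hy, hd⟩ :=
    ((ae_restrict_mem P.measurableSet).and (ae_restrict_of_ae hpos)).exists
  exact le_essInf_distw hα P hy hd (Filter.Eventually.of_forall distw_nonneg)

/-- The measure with density `dist(·,E)^{-α}`. -/
noncomputable def distMeasure (E : Set (EuclideanSpace ℝ (Fin n))) (α : ℝ) :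
    Measure (EuclideanSpace ℝ (Fin n)) :=
  volume.withDensity fun x => ENNReal.ofReal (distw E α x)

lemma distMeasure_apply {S : Set (EuclideanSpace ℝ (Fin n))} (hS : MeasurableSet S) :
    distMeasure E α S = ∫⁻ x in S, ENNReal.ofReal (distw E α x) :=
  withDensity_apply _ hS

lemma setAverage_distw (P : Cube n) :
    ⨍ x in P.set, distw E α x = (distMeasure E α P.set).toReal / P.l ^ n := by
  rw [setAverage_eq, distMeasure_apply P.measurableSet,
    integral_eq_lintegral_of_nonneg_ae (Filter.Eventually.of_forall distw_nonneg)
      measurable_distw.aestronglyMeasurable, measureReal_def, P.volume_real_set, smul_eq_mul,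
    div_eq_inv_mul]

lemma distMeasure_le (hα : 0 < α) {S : Set (EuclideanSpace ℝ (Fin n))} (hS : MeasurableSet S)
    {r : ℝ} (hr : 0 < r) (h : ∀ x ∈ S, r ≤ infDist x E) :
    distMeasure E α S ≤ ENNReal.ofReal (r ^ (-α)) * volume S := by
  rw [distMeasure_apply hS, ← setLIntegral_const]
  exact setLIntegral_mono' hS fun x hx => ENNReal.ofReal_le_ofReal (distw_le_rpow hα hr (h x hx))

lemma le_distMeasure (hα : 0 < α) (hpos : ∀ᵐ x ∂(volume : Measure (EuclideanSpace ℝ (Fin n))),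
    0 < infDist x E) {S : Set (EuclideanSpace ℝ (Fin n))} (hS : MeasurableSet S)
    {r : ℝ} (h : ∀ x ∈ S, infDist x E ≤ r) :
    ENNReal.ofReal (r ^ (-α)) * volume S ≤ distMeasure E α S := by
  rw [distMeasure_apply hS, ← setLIntegral_const]
  refine setLIntegral_mono_ae' hS ?_
  filter_upwards [hpos] with x hx hxS
  exact ENNReal.ofReal_le_ofReal (rpow_le_distw hα hx (h x hxS))

lemma ae_infDist_pos (hα : 0 < α) (hw : IsWeight (distw E α)) :
    ∀ᵐ x ∂(volume : Measure (EuclideanSpace ℝ (Fin n))), 0 < infDist x E := by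
  filter_upwards [hw.2] with x hx
  refine lt_of_le_of_ne infDist_nonneg fun h => ?_
  rw [distw, ← h, Real.zero_rpow (by linarith)] at hx
  exact lt_irrefl _ hx

lemma distMeasure_cube_lt_top (hw : IsWeight (distw E α)) (P : Cube n) :
    distMeasure E α P.set < ⊤ := by
  rw [distMeasure_apply P.measurableSet]
  have h : P.set ⊆ closedBall P.a ((n + 1) * P.l) := fun x hx => P.dist_le hx P.corner_mem
  exact ((hw.1.integrableOn_isCompact (isCompact_closedBall _ _)).mono_set h).lintegral_lt_top

lemma distMeasure_cube_le (hα : 0 < α) (hw : IsWeight (distw E α)) {C : ℝ}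
    (hC : A1With (distw E α) C) (P : Cube n) {y : EuclideanSpace ℝ (Fin n)} (hy : y ∈ P.set)
    {r : ℝ} (hr : 0 < r) (hry : r ≤ infDist y E) :
    distMeasure E α P.set ≤ ENNReal.ofReal (max C 0 * 2 ^ α * r ^ (-α)) * volume P.set := by
  rw [← ENNReal.ofReal_toReal (distMeasure_cube_lt_top hw P).ne, P.volume_set,
    ← ENNReal.ofReal_mul (by positivity)]
  refine ENNReal.ofReal_le_ofReal ?_
  have h := hC P
  rw [setAverage_distw] at h
  rw [← div_le_iff₀ (pow_pos P.pos n)]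
  have h1 := essInf_distw_le hα P hy (hr.trans_le hry)
  have h2 : (infDist y E / 2) ^ (-α) ≤ 2 ^ α * r ^ (-α) := by
    rw [Real.div_rpow infDist_nonneg (by norm_num), Real.rpow_neg (by norm_num : (0:ℝ) ≤ 2),
      div_inv_eq_mul, mul_comm]
    gcongr ?_ * ?_
    exact Real.rpow_le_rpow_of_nonpos hr hry (by linarith)
  calc _ ≤ C * essInf (distw E α) (volume.restrict P.set) := h
    _ ≤ max C 0 * essInf (distw E α) (volume.restrict P.set) := by
        gcongr
        · exact essInf_distw_nonneg hα (ae_infDist_pos hα hw) P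
        · exact le_max_left _ _
    _ ≤ max C 0 * (2 ^ α * r ^ (-α)) := by
        gcongr
        exact h1.trans h2
    _ = _ := by ring

lemma measure_sublevel_le_add (ν : Measure (EuclideanSpace ℝ (Fin n))) {K : ENNReal} {r : ℝ}
    (h : ∀ P : Cube n, (∃ y ∈ P.set, r ≤ infDist y E) → ν P.set ≤ K * volume P.set) (j : ℕ) :
    ∀ P : Cube n, (∃ y ∈ P.set, r ≤ infDist y E) →
      ν (P.set ∩ {x | infDist x E < r}) ≤
        ENNReal.ofReal (2 ^ n) * K * volume (P.set ∩ {x | infDist x E < r}) +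
        ν (P.set ∩ {x | r - (n + 1) * P.l / 2 ^ j ≤ infDist x E ∧ infDist x E < r}) := by
  have hmeas : Measurable fun x => infDist x E := measurable_infDist
  have hD : MeasurableSet {x | infDist x E < r} := measurableSet_lt hmeas measurable_const
  induction j with
  | zero =>
    rintro P ⟨y, hy, hry⟩
    refine le_add_left (measure_mono fun x hx => ⟨hx.1, ?_, hx.2⟩)
    have h1 := P.dist_le hy hx.1
    have h2 : infDist y E ≤ infDist x E + dist y x := infDist_le_infDist_add_dist
    simp only [pow_zero, div_one]
    linarith
  | succ j ih =>
    intro P hP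
    have hT : MeasurableSet
        {x | r - (n + 1) * P.l / 2 ^ (j + 1) ≤ infDist x E ∧ infDist x E < r} :=
      (measurableSet_le measurable_const hmeas).inter hD
    rw [P.measure_inter_eq_sum_child ν hD, P.measure_inter_eq_sum_child volume hD,
      P.measure_inter_eq_sum_child ν hT, Finset.mul_sum, ← Finset.sum_add_distrib]
    refine Finset.sum_le_sum fun k _ => ?_
    by_cases hk : ∃ y ∈ (P.child k).set, r ≤ infDist y E
    · refine (ih _ hk).trans_eq ?_
      have : (n + 1) * (P.child k).l / 2 ^ j = (n + 1) * P.l / 2 ^ (j + 1) := by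
        simp only [Cube.child]
        ring
      rw [this]
    · push Not at hk
      rw [inter_eq_left.2 (show (P.child k).set ⊆ {x | infDist x E < r} from hk)]
      refine le_add_right ?_
      calc ν (P.child k).set ≤ ν P.set := by
            rw [← P.iUnion_child]
            exact measure_mono (subset_iUnion (fun k => (P.child k).set) k)
        _ ≤ K * volume P.set := h P hP
        _ = _ := by rw [P.volume_set_eq_child k]; ring

/-- A stopping-time estimate: bounds on cubes reaching distance `r` from `E` sum up to a bound
on the part of a cube closer to `E` than `r`. -/
lemma measure_sublevel_le (ν : Measure (EuclideanSpace ℝ (Fin n))) {K : ENNReal} {r : ℝ}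
    (h : ∀ P : Cube n, (∃ y ∈ P.set, r ≤ infDist y E) → ν P.set ≤ K * volume P.set)
    (P : Cube n) (hP : ∃ y ∈ P.set, r ≤ infDist y E) (hfin : ν P.set ≠ ⊤) :
    ν (P.set ∩ {x | infDist x E < r}) ≤
      ENNReal.ofReal (2 ^ n) * K * volume (P.set ∩ {x | infDist x E < r}) := by
  have hl := P.pos
  have hmeas : Measurable fun x => infDist x E := measurable_infDist
  set T : ℕ → Set (EuclideanSpace ℝ (Fin n)) := fun j =>
    P.set ∩ {x | r - (n + 1) * P.l / 2 ^ j ≤ infDist x E ∧ infDist x E < r} with hT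
  have hTm : ∀ j, MeasurableSet (T j) := fun j => P.measurableSet.inter
    ((measurableSet_le measurable_const hmeas).inter (measurableSet_lt hmeas measurable_const))
  have hanti : Antitone T := by
    intro i j hij x hx
    refine ⟨hx.1, le_trans ?_ hx.2.1, hx.2.2⟩
    have : (n + 1) * P.l / 2 ^ j ≤ (n + 1) * P.l / 2 ^ i := by
      gcongr
      norm_num
    linarith
  have hempty : ⋂ j, T j = ∅ := by
    refine eq_empty_of_forall_notMem fun x hx => ?_
    rw [mem_iInter] at hx
    have hlim : Filter.Tendsto (fun j : ℕ => r - (n + 1) * P.l / 2 ^ j) Filter.atTop (nhds r) := by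
      have h1 := (tendsto_pow_atTop_nhds_zero_of_lt_one (r := (1 / 2 : ℝ)) (by norm_num)
        (by norm_num)).const_mul ((n + 1) * P.l)
      simpa [div_eq_mul_inv] using h1.const_sub r
    exact absurd (le_of_tendsto' hlim fun j => (hx j).2.1) (not_le.2 (hx 0).2.2)
  have hlim := tendsto_measure_iInter_atTop (μ := ν) (fun j => (hTm j).nullMeasurableSet) hanti
    ⟨0, ne_top_of_le_ne_top hfin (measure_mono inter_subset_left)⟩
  rw [hempty, measure_empty] at hlim
  have hlim2 := hlim.const_add
    (ENNReal.ofReal (2 ^ n) * K * volume (P.set ∩ {x | infDist x E < r}))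
  rw [add_zero] at hlim2
  exact ge_of_tendsto' hlim2 fun j => measure_sublevel_le_add ν h j P hP

/-- The real-variable self-improvement: if `F` is an `r^{-α}`-weighted integral of `dm` which is
also controlled by `r^{-α} m`, then `m` decays at a rate strictly better than `α`. -/
lemma exists_improved_decay (hα : 0 < α) {A : ℝ} (hA : 2 ≤ A) :
    ∃ β K : ℝ, α < β ∧ 0 < K ∧ ∀ (F m : ℝ → ℝ) (H : ℝ), 0 < H → Monotone m → (∀ r, 0 ≤ m r) →
      (∀ r, 0 < r → r ≤ H → F r ≤ A * r ^ (-α) * m r) →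
      (∀ s r, 0 < s → s ≤ r → F s + r ^ (-α) * (m r - m s) ≤ F r) →
      (∀ s, 0 < s → s ^ (-α) * m s ≤ F s) →
      ∀ r, 0 < r → r ≤ H → m r ≤ K * (r / H) ^ β * m H := by
  set θ : ℝ := (2 * A) ^ (-α⁻¹) with hθ
  have hθ0 : 0 < θ := by positivity
  have hθα : A * θ ^ α = 1 / 2 := by
    rw [hθ, ← Real.rpow_mul (by positivity), neg_mul, inv_mul_cancel₀ hα.ne', Real.rpow_neg_one]
    field_simp
  have hθ1 : θ < 1 := Real.rpow_lt_one_of_one_lt_of_neg (by linarith) (by simpa using hα)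
  set q : ℝ := (A - 1) / (A - 1 / 2) with hq
  have hq0 : 0 < q := div_pos (by linarith) (by linarith)
  have hq1 : q < 1 := by rw [hq, div_lt_one (by linarith)]; linarith
  have hlθ : Real.log θ < 0 := Real.log_neg hθ0 hθ1
  set ε : ℝ := Real.log q / Real.log θ with hε
  have hε0 : 0 < ε := div_pos_of_neg_of_neg (Real.log_neg hq0 hq1) hlθ
  have hqθ : θ ^ ε = q := by
    rw [Real.rpow_def_of_pos hθ0, hε, mul_div_cancel₀ _ hlθ.ne, Real.exp_log hq0]
  refine ⟨α + ε, A * θ ^ (-(α + ε)), by linarith, by positivity, ?_⟩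
  intro F m H hH hmono hm h1 h2 h3 r hr hrH
  have hstep : ∀ r, 0 < r → r ≤ H → F (θ * r) ≤ q * F r := by
    intro r hr hrH
    have hs : 0 < θ * r := by positivity
    have e1 := h1 r hr hrH
    have e2 := h2 (θ * r) r hs (by nlinarith)
    have e3 := h3 (θ * r) hs
    have e4 : r ^ (-α) * m (θ * r) ≤ θ ^ α * F (θ * r) := by
      rw [Real.mul_rpow hθ0.le hr.le, Real.rpow_neg hθ0.le] at e3
      have := mul_le_mul_of_nonneg_left e3 (Real.rpow_nonneg hθ0.le α)
      rwa [← mul_assoc, ← mul_assoc, mul_inv_cancel₀ (by positivity), one_mul] at this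
    have e5 : (A - 1 / 2) * F (θ * r) ≤ (A - 1) * F r := by
      have e6 := mul_le_mul_of_nonneg_left e2 (by linarith : 0 ≤ A)
      have e7 := mul_le_mul_of_nonneg_left e4 (by linarith : 0 ≤ A)
      rw [← mul_assoc A (θ ^ α), hθα] at e7
      linarith
    rw [hq, div_mul_eq_mul_div, le_div_iff₀ (by linarith)]
    linarith
  have hiter : ∀ k : ℕ, F (θ ^ k * H) ≤ q ^ k * F H := by
    intro k
    induction k with
    | zero => simp
    | succ k ih =>
      have := hstep (θ ^ k * H) (by positivity)
        (mul_le_of_le_one_left hH.le (pow_le_one₀ hθ0.le hθ1.le))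
      calc F (θ ^ (k + 1) * H) = F (θ * (θ ^ k * H)) := by ring_nf
        _ ≤ q * F (θ ^ k * H) := this
        _ ≤ q * (q ^ k * F H) := by gcongr
        _ = _ := by ring
  obtain ⟨k, hk1, hk2⟩ := exists_nat_pow_near_of_lt_one (x := r / H) (by positivity)
    ((div_le_one hH).2 hrH) hθ0 hθ1
  have hk : 0 < θ ^ k := by positivity
  have hmk : m (θ ^ k * H) ≤ A * (θ ^ k) ^ (α + ε) * m H := by
    have e3 := h3 (θ ^ k * H) (by positivity)
    have e1 := h1 H hH le_rfl
    have e4 : q ^ k = (θ ^ k) ^ ε := by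
      rw [← hqθ, ← Real.rpow_natCast, ← Real.rpow_natCast, ← Real.rpow_mul hθ0.le,
        ← Real.rpow_mul hθ0.le, mul_comm]
    have e5 : (θ ^ k * H) ^ (-α) * m (θ ^ k * H) ≤ q ^ k * (A * H ^ (-α) * m H) :=
      (e3.trans (hiter k)).trans (by gcongr)
    rw [Real.mul_rpow hk.le hH.le, Real.rpow_neg hk.le, e4] at e5
    rw [Real.rpow_add hk]
    have hHα : 0 < H ^ (-α) := by positivity
    have hkα : 0 < (θ ^ k) ^ α := by positivity
    have e6 := mul_le_mul_of_nonneg_left e5 hkα.le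
    refine le_of_mul_le_mul_left (a := H ^ (-α)) ?_ hHα
    calc H ^ (-α) * m (θ ^ k * H)
        = (θ ^ k) ^ α * (((θ ^ k) ^ α)⁻¹ * H ^ (-α) * m (θ ^ k * H)) := by field_simp
      _ ≤ _ := e6
      _ = _ := by ring
  calc m r ≤ m (θ ^ k * H) := hmono ((div_le_iff₀ hH).1 hk2)
    _ ≤ A * (θ ^ k) ^ (α + ε) * m H := hmk
    _ ≤ A * (θ ^ (-(α + ε)) * (r / H) ^ (α + ε)) * m H := by
        gcongr
        · exact hm H
        · rw [Real.rpow_neg hθ0.le, inv_mul_eq_div, ← Real.div_rpow (by positivity) hθ0.le]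
          refine Real.rpow_le_rpow hk.le ?_ (by linarith)
          rw [le_div_iff₀ hθ0, ← pow_succ]
          exact hk1.le
    _ = _ := by ring

lemma volume_real_ball (x : EuclideanSpace ℝ (Fin n)) {R : ℝ} (hR : 0 < R) :
    (volume (ball x R)).toReal =
      R ^ n * (volume (ball (0 : EuclideanSpace ℝ (Fin n)) 1)).toReal := by
  rw [Measure.addHaar_ball_of_pos volume x hR, finrank_euclideanSpace_fin, ENNReal.toReal_mul,
    ENNReal.toReal_ofReal (pow_nonneg hR.le n)]

lemma volume_real_unit_ball_pos :
    0 < (volume (ball (0 : EuclideanSpace ℝ (Fin n)) 1)).toReal :=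
  ENNReal.toReal_pos (measure_ball_pos _ _ one_pos).ne' measure_ball_lt_top.ne

lemma le_of_ball_subset_diff {x y : EuclideanSpace ℝ (Fin n)} {R t : ℝ} (hx : x ∈ E)
    (hy : y ∈ ball x R) (h : ball y t ⊆ ball x R \ E) : t ≤ R := by
  by_contra! hlt
  refine (h (?_ : x ∈ ball y t)).2 hx
  rw [mem_ball, dist_comm]
  exact lt_trans hy hlt

lemma hFree_le {x : EuclideanSpace ℝ (Fin n)} {R : ℝ} (hx : x ∈ E) (hR : 0 ≤ R) :
    hFree E x R ≤ R :=
  Real.sSup_le (fun _ ⟨_, hy, h⟩ => le_of_ball_subset_diff hx hy h) hR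

lemma le_hFree {x y : EuclideanSpace ℝ (Fin n)} {R t : ℝ} (hx : x ∈ E) (hy : y ∈ ball x R)
    (ht : t ≤ infDist y E) (htR : t ≤ R - dist y x) : t ≤ hFree E x R := by
  refine le_csSup ⟨R, fun _ ⟨_, hz, h⟩ => le_of_ball_subset_diff hx hz h⟩
    ⟨y, hy, fun z hz => ⟨?_, fun hzE => ?_⟩⟩
  · rw [mem_ball] at hz ⊢
    linarith [dist_triangle z y x]
  · rw [mem_ball, dist_comm] at hz
    linarith [infDist_le_dist_of_mem (x := y) hzE]

lemma exists_infDist_of_lt_hFree {x : EuclideanSpace ℝ (Fin n)} {R s : ℝ} (hx : x ∈ E)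
    (hs : 0 ≤ s) (h : s < hFree E x R) : ∃ y ∈ ball x R, s < infDist y E := by
  rcases Set.eq_empty_or_nonempty {t : ℝ | ∃ y ∈ ball x R, ball y t ⊆ ball x R \ E} with he | he
  · rw [hFree, he, Real.sSup_empty] at h
    exact absurd h (not_lt.2 hs)
  · obtain ⟨t, ⟨y, hy, hyt⟩, hst⟩ := exists_lt_of_lt_csSup he h
    refine ⟨y, hy, hst.trans_le ((le_infDist ⟨x, hx⟩).2 fun z hz => ?_)⟩
    by_contra! hlt
    exact (hyt (by rwa [mem_ball, dist_comm])).2 hz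

lemma hFree_pos (hpos : ∀ᵐ x ∂(volume : Measure (EuclideanSpace ℝ (Fin n))), 0 < infDist x E)
    {x : EuclideanSpace ℝ (Fin n)} (hx : x ∈ E) {R : ℝ} (hR : 0 < R) : 0 < hFree E x R := by
  have : (ae (volume.restrict (ball x R))).NeBot :=
    ae_restrict_neBot.2 (measure_ball_pos volume x hR).ne'
  obtain ⟨y, hy, hd⟩ := ((ae_restrict_mem (μ := volume) (measurableSet_ball (x := x) (ε := R))).and
    (ae_restrict_of_ae hpos)).exists
  have hy' : dist y x < R := hy
  exact (lt_min hd (sub_pos.2 hy')).trans_le (le_hFree hx hy (min_le_left _ _) (min_le_right _ _))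

lemma le_of_mem_muckSet {x : EuclideanSpace ℝ (Fin n)} (hx : x ∈ E)
    (hh : ∀ R : ℝ, 0 < R → 0 < hFree E x R) {β : ℝ} (hβ : β ∈ MuckSet E) : β ≤ n := by
  obtain ⟨C, hC⟩ := hβ
  by_contra! hlt
  have h0 := hh 1 one_pos
  set h := hFree E x 1
  have h1 : h ≤ 1 := hFree_le hx zero_le_one
  set v := (volume (ball (0 : EuclideanSpace ℝ (Fin n)) 1)).toReal
  have hv : 0 < v := volume_real_unit_ball_pos
  have key : ∀ r : ℝ, 0 < r → r < h → 1 ≤ C * h ^ (-β) * r ^ (β - n) := by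
    intro r hr hrh
    have h2 := hC x hx 1 r hr hrh h1
    have h3 : (volume (ball x r)).toReal ≤ (volume (thickening r E ∩ ball x 1)).toReal := by
      refine ENNReal.toReal_mono
        (ne_top_of_le_ne_top measure_ball_lt_top.ne (measure_mono inter_subset_right))
        (measure_mono fun z hz => ⟨mem_thickening_iff.2 ⟨x, hx, hz⟩, ?_⟩)
      exact ball_subset_ball (hrh.le.trans h1) hz
    have h4 := h3.trans h2
    rw [volume_real_ball x hr, volume_real_ball x one_pos, one_pow, one_mul] at h4
    have h5 := le_of_mul_le_mul_right h4 hv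
    rw [Real.div_rpow h0.le hr.le, Real.rpow_neg hr.le, div_inv_eq_mul] at h5
    have hrn : 0 < r ^ n := by positivity
    rw [Real.rpow_sub hr, Real.rpow_natCast, mul_div_assoc', le_div_iff₀ hrn, one_mul, mul_assoc]
    exact h5
  have hlim : Filter.Tendsto (fun r : ℝ => C * h ^ (-β) * r ^ (β - n))
      (nhdsWithin 0 (Ioi 0)) (nhds 0) := by
    have h2 : Filter.Tendsto (fun r : ℝ => r ^ (β - n)) (nhds 0) (nhds 0) := by
      have := (Real.continuousAt_rpow_const 0 (β - n) (Or.inr (by linarith))).tendsto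
      rwa [Real.zero_rpow (by linarith)] at this
    simpa using (h2.mono_left nhdsWithin_le_nhds).const_mul (C * h ^ (-β))
  have h6 : (1 : ℝ) ≤ 0 := by
    refine ge_of_tendsto hlim ?_
    filter_upwards [Ioo_mem_nhdsGT h0] with r hr
    exact key r hr.1 hr.2
  linarith

lemma exists_mem_muckSet_of_memA1 (hne : E.Nonempty) (hα : 0 < α) (hw : MemA1 (distw E α)) :
    ∃ β ∈ MuckSet E, α < β := by
  obtain ⟨hW, C, hC⟩ := hw
  have hpos := ae_infDist_pos hα hW
  have hdist : Measurable fun x => infDist x E := measurable_infDist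
  have hD : ∀ r, MeasurableSet {x | infDist x E < r} := fun r =>
    measurableSet_lt hdist measurable_const
  set A₀ : ℝ := max C 0 * 2 ^ α
  have hA₀ : 0 ≤ A₀ := by positivity
  obtain ⟨β, K, hβ, hK, hdecay⟩ := exists_improved_decay hα (le_max_left 2 (2 ^ n * A₀))
  set v := (volume (ball (0 : EuclideanSpace ℝ (Fin n)) 1)).toReal
  have hv : 0 < v := volume_real_unit_ball_pos
  refine ⟨β, ⟨max K 1 * 2 ^ β * (2 ^ n / v), ?_⟩, hβ⟩
  intro x hx R r hr hrh hhR
  set h := hFree E x R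
  have hh : 0 < h := hr.trans hrh
  have hR : 0 < R := hh.trans_le hhR
  set Q := Cube.circumscribed x R hR
  obtain ⟨y, hy, hyd⟩ := exists_infDist_of_lt_hFree hx (half_pos hh).le (half_lt_self hh)
  have hyQ : y ∈ Q.set := Cube.ball_subset_circumscribed x hR hy
  set ν := distMeasure E α
  have hνQ : ν Q.set ≠ ⊤ := (distMeasure_cube_lt_top hW Q).ne
  have hνfin : ∀ S, ν (Q.set ∩ S) ≠ ⊤ := fun S =>
    ne_top_of_le_ne_top hνQ (measure_mono inter_subset_left)
  have hfin : ∀ S, volume (Q.set ∩ S) ≠ ⊤ := fun S =>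
    ne_top_of_le_ne_top Q.volume_set_ne_top (measure_mono inter_subset_left)
  set m : ℝ → ℝ := fun s => (volume (Q.set ∩ {z | infDist z E < s})).toReal with hm
  have hmono : Monotone m := fun s s' hs => ENNReal.toReal_mono (hfin _)
    (measure_mono fun z hz => ⟨hz.1, lt_of_lt_of_le hz.2 hs⟩)
  have hmQ : ∀ s, m s ≤ 2 ^ n * R ^ n := by
    intro s
    rw [← mul_pow, show 2 * R = Q.l from rfl, ← Q.volume_real_set]
    exact ENNReal.toReal_mono Q.volume_set_ne_top (measure_mono inter_subset_left)
  have hmain := hdecay (fun s => (ν (Q.set ∩ {z | infDist z E < s})).toReal) m (h / 2)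
    (half_pos hh) hmono (fun _ => ENNReal.toReal_nonneg) ?_ ?_ ?_
  · have hm_le : m r ≤ max K 1 * (r / (h / 2)) ^ β * (2 ^ n * R ^ n) := by
      rcases le_total r (h / 2) with hle | hle
      · refine (hmain r hr hle).trans ?_
        gcongr
        · exact le_max_left _ _
        · exact hmQ _
      · refine (hmQ r).trans (le_mul_of_one_le_left (by positivity) ?_)
        refine one_le_mul_of_one_le_of_one_le (le_max_right _ _) (Real.one_le_rpow ?_ (by linarith))
        rwa [one_le_div (by positivity)]
    rw [volume_real_ball x hR]
    calc (volume (thickening r E ∩ ball x R)).toReal ≤ m r := by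
          refine ENNReal.toReal_mono (hfin _) (measure_mono fun z hz =>
            ⟨Cube.ball_subset_circumscribed x hR hz.2,
              (mem_thickening_iff_infDist_lt hne).1 hz.1⟩)
      _ ≤ _ := hm_le
      _ = _ := by
          rw [Real.rpow_neg (by positivity), ← Real.inv_rpow (by positivity), inv_div,
            show r / (h / 2) = 2 * (r / h) by field_simp,
            Real.mul_rpow (by norm_num) (by positivity)]
          field_simp
          rfl
  · intro s hs hsh
    have hest := measure_sublevel_le ν (K := ENNReal.ofReal (A₀ * s ^ (-α)))
      (fun P ⟨z, hz, hzs⟩ => distMeasure_cube_le hα hW hC P hz hs hzs) Q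
      ⟨y, hyQ, hsh.trans hyd.le⟩ hνQ
    have hest' := ENNReal.toReal_mono (ENNReal.mul_ne_top (ENNReal.mul_ne_top
      ENNReal.ofReal_ne_top ENNReal.ofReal_ne_top) (hfin _)) hest
    rw [ENNReal.toReal_mul, ENNReal.toReal_mul, ENNReal.toReal_ofReal (by positivity),
      ENNReal.toReal_ofReal (by positivity)] at hest'
    refine hest'.trans ?_
    rw [← mul_assoc (2 ^ n)]
    gcongr
    exact le_max_right _ _
  · intro s s' hs hss'
    have hsub : {z | infDist z E < s} ⊆ {z | infDist z E < s'} :=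
      fun z hz => lt_of_lt_of_le hz hss'
    have hsplit : ∀ μ : Measure (EuclideanSpace ℝ (Fin n)), (∀ S, μ (Q.set ∩ S) ≠ ⊤) →
        (μ (Q.set ∩ {z | infDist z E < s'})).toReal =
          (μ (Q.set ∩ {z | infDist z E < s})).toReal +
          (μ (Q.set ∩ ({z | infDist z E < s'} \ {z | infDist z E < s}))).toReal := by
      intro μ hμ
      rw [← ENNReal.toReal_add (hμ _) (hμ _), ← measure_union, ← inter_union_distrib_left,
        union_sdiff_cancel hsub]
      · exact Disjoint.mono inter_subset_right inter_subset_right disjoint_sdiff_right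
      · exact Q.measurableSet.inter ((hD s').diff (hD s))
    have hlow := ENNReal.toReal_mono (hνfin _) (le_distMeasure hα hpos
      (Q.measurableSet.inter ((hD s').diff (hD s))) (r := s') fun z hz => le_of_lt hz.2.1)
    rw [ENNReal.toReal_mul, ENNReal.toReal_ofReal (Real.rpow_nonneg (hs.le.trans hss') _)] at hlow
    have e1 := hsplit ν hνfin
    have e2 := hsplit volume hfin
    simp only [hm]
    rw [e1, e2, add_sub_cancel_left]
    linarith
  · intro s hs
    have hlow := ENNReal.toReal_mono (hνfin _) (le_distMeasure hα hpos
      (Q.measurableSet.inter (hD s)) (r := s) fun z hz => le_of_lt hz.2)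
    rwa [ENNReal.toReal_mul, ENNReal.toReal_ofReal (by positivity)] at hlow

lemma ae_infDist_pos_of_muck (hne : E.Nonempty)
    (hh : ∀ x ∈ E, ∀ R : ℝ, 0 < R → 0 < hFree E x R) {β : ℝ} (hβ0 : 0 < β)
    (hβ : β ∈ MuckSet E) :
    ∀ᵐ x ∂(volume : Measure (EuclideanSpace ℝ (Fin n))), 0 < infDist x E := by
  obtain ⟨C, hC⟩ := hβ
  obtain ⟨x, hx⟩ := hne
  have hball : ∀ R : ℝ, 0 < R → volume ({z | ¬ 0 < infDist z E} ∩ ball x R) = 0 := by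
    intro R hR
    have hfin : ∀ S, volume (S ∩ ball x R) ≠ ⊤ := fun S =>
      ne_top_of_le_ne_top measure_ball_lt_top.ne (measure_mono inter_subset_right)
    have h0 := hh x hx R hR
    set h := hFree E x R
    set V := (volume (ball x R)).toReal
    have hlim : Filter.Tendsto (fun r : ℝ => C * (h ^ (-β) * r ^ β) * V)
        (nhdsWithin 0 (Ioi 0)) (nhds 0) := by
      have h2 : Filter.Tendsto (fun r : ℝ => r ^ β) (nhds 0) (nhds 0) := by
        have := (Real.continuousAt_rpow_const 0 β (Or.inr hβ0.le)).tendsto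
        rwa [Real.zero_rpow hβ0.ne'] at this
      simpa using (((h2.mono_left nhdsWithin_le_nhds).const_mul (h ^ (-β))).const_mul C).mul_const V
    have hle : (volume ({z | ¬ 0 < infDist z E} ∩ ball x R)).toReal ≤ 0 := by
      refine ge_of_tendsto hlim ?_
      filter_upwards [Ioo_mem_nhdsGT h0] with r hr
      have h1 := hC x hx R r hr.1 hr.2 (hFree_le hx hR.le)
      rw [Real.div_rpow h0.le hr.1.le, Real.rpow_neg hr.1.le, div_inv_eq_mul] at h1
      refine le_trans (ENNReal.toReal_mono (hfin _) (measure_mono fun z hz => ⟨?_, hz.2⟩)) h1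
      exact (mem_thickening_iff_infDist_lt ⟨x, hx⟩).2 ((not_lt.1 hz.1).trans_lt hr.1)
    exact ((ENNReal.toReal_eq_zero_iff _).1 (le_antisymm hle ENNReal.toReal_nonneg)).resolve_right
      (hfin _)
  rw [ae_iff]
  refine measure_mono_null (t := ⋃ N : ℕ, {z | ¬ 0 < infDist z E} ∩ ball x (N + 1))
    (fun z hz => ?_) (measure_iUnion_null fun N => hball _ (by positivity))
  obtain ⟨N, hN⟩ := exists_nat_gt (dist z x)
  exact mem_iUnion.2 ⟨N, hz, by rw [mem_ball]; linarith⟩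

lemma exists_distMeasure_ball_le (hne : E.Nonempty) (hα : 0 < α)
    (hpos : ∀ᵐ x ∂(volume : Measure (EuclideanSpace ℝ (Fin n))), 0 < infDist x E)
    {β : ℝ} (hαβ : α < β) (hβ : β ∈ MuckSet E) :
    ∃ K : ℝ, 0 ≤ K ∧ ∀ x ∈ E, ∀ R : ℝ, 0 < R → 0 < hFree E x R →
      distMeasure E α (ball x R) ≤
        ENNReal.ofReal (K * hFree E x R ^ (-α)) * volume (ball x R) := by
  have hdist : Measurable fun x => infDist x E := measurable_infDist
  obtain ⟨C, hC⟩ := hβ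
  set ρ : ℝ := 2 ^ α * 2 ^ (-β) with hρ
  have hρ0 : 0 < ρ := by positivity
  have hρ1 : ρ < 1 := by
    rw [hρ, ← Real.rpow_add two_pos]
    exact Real.rpow_lt_one_of_one_lt_of_neg one_lt_two (by linarith)
  have hsum : Summable fun k : ℕ => ρ ^ (k + 1) :=
    (summable_nat_add_iff 1).2 (summable_geometric_of_lt_one hρ0.le hρ1)
  have htsum : 0 ≤ ∑' k : ℕ, ρ ^ (k + 1) := tsum_nonneg fun k => by positivity
  refine ⟨4 ^ α + max C 0 * 4 ^ α * ∑' k : ℕ, ρ ^ (k + 1), by positivity, ?_⟩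
  intro x hx R hR h0
  have hhR : hFree E x R ≤ R := hFree_le hx hR.le
  have hC' := hC x hx R
  set h := hFree E x R
  set B := ball x R
  have hB : MeasurableSet B := measurableSet_ball
  have hBfin : volume B ≠ ⊤ := measure_ball_lt_top.ne
  set ν := distMeasure E α
  set T : ℕ → Set (EuclideanSpace ℝ (Fin n)) := fun k =>
    B ∩ {z | h / 2 ^ (k + 3) ≤ infDist z E ∧ infDist z E < h / 2 ^ (k + 1)} with hT
  have hTm : ∀ k, MeasurableSet (T k) := fun k => hB.inter
    ((measurableSet_le measurable_const hdist).inter (measurableSet_lt hdist measurable_const))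
  have hfar : MeasurableSet (B ∩ {z | h / 4 ≤ infDist z E}) :=
    hB.inter (measurableSet_le measurable_const hdist)
  have hcover : B ⊆ ({z | ¬ 0 < infDist z E} ∪ (B ∩ {z | h / 4 ≤ infDist z E})) ∪ ⋃ k, T k := by
    intro z hz
    by_cases hz0 : 0 < infDist z E
    · rcases le_or_gt (h / 4) (infDist z E) with hle | hlt
      · exact Or.inl (Or.inr ⟨hz, hle⟩)
      · obtain ⟨k, hk1, hk2⟩ := exists_nat_pow_near_of_lt_one (x := infDist z E / (h / 4))
          (y := (1 / 2 : ℝ)) (by positivity) ((div_le_one (by positivity)).2 hlt.le)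
          (by norm_num) (by norm_num)
        rw [lt_div_iff₀ (by positivity)] at hk1
        rw [div_le_iff₀ (by positivity)] at hk2
        have hp : (0 : ℝ) < (1 / 2) ^ k := by positivity
        refine Or.inr (mem_iUnion.2 ⟨k, hz, ?_, ?_⟩)
        · refine le_trans (le_of_eq ?_) hk1.le
          rw [one_div, inv_pow, pow_add, pow_add]
          field_simp
          norm_num
        · refine lt_of_le_of_lt hk2 ?_
          have : h / 2 ^ (k + 1) = (1 / 2) ^ k * (h / 2) := by
            rw [one_div, inv_pow, pow_add]
            field_simp
          rw [this]
          gcongr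
          norm_num
    · exact Or.inl (Or.inl hz0)
  have hnull : ν {z | ¬ 0 < infDist z E} = 0 :=
    withDensity_absolutelyContinuous _ _ (ae_iff.1 hpos)
  have hfar_le : ν (B ∩ {z | h / 4 ≤ infDist z E}) ≤
      ENNReal.ofReal (4 ^ α * h ^ (-α)) * volume B := by
    refine (distMeasure_le hα hfar (r := h / 4) (by positivity) fun z hz => hz.2).trans ?_
    rw [Real.div_rpow h0.le (by norm_num), Real.rpow_neg (by norm_num : (0:ℝ) ≤ 4),
      div_inv_eq_mul, mul_comm (h ^ (-α))]
    gcongr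
    exact inter_subset_left
  have hT_le : ∀ k, ν (T k) ≤
      ENNReal.ofReal (max C 0 * 4 ^ α * h ^ (-α) * ρ ^ (k + 1)) * volume B := by
    intro k
    have hV : volume (T k) ≤ ENNReal.ofReal (max C 0 * (2 ^ (k + 1)) ^ (-β)) * volume B := by
      have hr1 : h / 2 ^ (k + 1) < h := div_lt_self h0 (one_lt_pow₀ one_lt_two (by omega))
      have h1 := hC' (h / 2 ^ (k + 1)) (by positivity) hr1 hhR
      rw [div_div_cancel₀ h0.ne'] at h1
      have h2 : (volume (thickening (h / 2 ^ (k + 1)) E ∩ B)).toReal ≤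
          max C 0 * (2 ^ (k + 1)) ^ (-β) * (volume B).toReal := by
        refine h1.trans ?_
        gcongr
        exact le_max_left _ _
      calc volume (T k) ≤ volume (thickening (h / 2 ^ (k + 1)) E ∩ B) :=
            measure_mono fun z hz => ⟨(mem_thickening_iff_infDist_lt hne).2 hz.2.2, hz.1⟩
        _ = ENNReal.ofReal (volume (thickening (h / 2 ^ (k + 1)) E ∩ B)).toReal :=
            (ENNReal.ofReal_toReal
              (ne_top_of_le_ne_top hBfin (measure_mono inter_subset_right))).symm
        _ ≤ ENNReal.ofReal (max C 0 * (2 ^ (k + 1)) ^ (-β) * (volume B).toReal) :=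
            ENNReal.ofReal_le_ofReal h2
        _ = _ := by rw [ENNReal.ofReal_mul (by positivity), ENNReal.ofReal_toReal hBfin]
    refine (distMeasure_le hα (hTm k) (r := h / 2 ^ (k + 3)) (by positivity)
      fun z hz => hz.2.1).trans ?_
    refine (mul_le_mul_right hV _).trans_eq ?_
    rw [← mul_assoc, ← ENNReal.ofReal_mul (by positivity)]
    congr 2
    rw [Real.div_rpow h0.le (by positivity), Real.rpow_neg (by positivity : (0:ℝ) ≤ 2 ^ (k + 3)),
      div_inv_eq_mul, hρ, mul_pow, ← Real.rpow_pow_comm two_pos.le, ← Real.rpow_pow_comm two_pos.le,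
      show (4 : ℝ) = 2 ^ 2 by norm_num, ← Real.rpow_pow_comm two_pos.le]
    ring
  calc ν B ≤ ν {z | ¬ 0 < infDist z E} + ν (B ∩ {z | h / 4 ≤ infDist z E}) + ∑' k, ν (T k) := by
        refine (measure_mono hcover).trans ((measure_union_le _ _).trans ?_)
        exact add_le_add (measure_union_le _ _) (measure_iUnion_le _)
    _ ≤ 0 + ENNReal.ofReal (4 ^ α * h ^ (-α)) * volume B +
        ∑' k : ℕ, ENNReal.ofReal (max C 0 * 4 ^ α * h ^ (-α) * ρ ^ (k + 1)) * volume B :=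
        add_le_add (add_le_add hnull.le hfar_le) (ENNReal.tsum_le_tsum hT_le)
    _ = _ := by
        rw [ENNReal.tsum_mul_right, ← ENNReal.ofReal_tsum_of_nonneg (fun k => by positivity)
          (hsum.mul_left _), tsum_mul_left, zero_add, ← add_mul,
          ← ENNReal.ofReal_add (by positivity) (by positivity)]
        congr 2
        ring

lemma setAverage_distw_le {P : Cube n} {b : ℝ} (hb : 0 ≤ b)
    (h : distMeasure E α P.set ≤ ENNReal.ofReal b * volume P.set) :
    ⨍ x in P.set, distw E α x ≤ b := by
  rw [setAverage_distw, div_le_iff₀ (pow_pos P.pos n)]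
  have := ENNReal.toReal_mono (ENNReal.mul_ne_top ENNReal.ofReal_ne_top P.volume_set_ne_top) h
  rwa [ENNReal.toReal_mul, ENNReal.toReal_ofReal hb, P.volume_real_set] at this

lemma memA1_of_mem_muckSet (hne : E.Nonempty) (hα : 0 < α)
    (hh : ∀ x ∈ E, ∀ R : ℝ, 0 < R → 0 < hFree E x R) {β : ℝ} (hαβ : α < β)
    (hβ : β ∈ MuckSet E) : MemA1 (distw E α) := by
  have hpos := ae_infDist_pos_of_muck hne hh (hα.trans hαβ) hβ
  obtain ⟨K, hK, hball⟩ := exists_distMeasure_ball_le hne hα hpos hαβ hβ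
  set v := (volume (ball (0 : EuclideanSpace ℝ (Fin n)) 1)).toReal with hv_def
  have hv : 0 < v := volume_real_unit_ball_pos
  refine ⟨⟨?_, ?_⟩, max (3 ^ α) (K * (6 * (n + 1)) ^ n * v), fun P => ?_⟩
  · obtain ⟨x, hx⟩ := hne
    intro y
    have hR : 0 < dist y x + 1 := by positivity
    refine ⟨ball x (dist y x + 1), isOpen_ball.mem_nhds (by simp [mem_ball]),
      measurable_distw.aestronglyMeasurable, ?_⟩
    rw [hasFiniteIntegral_iff_ofReal (Filter.Eventually.of_forall fun x => distw_nonneg x),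
      ← distMeasure_apply measurableSet_ball]
    exact (hball x hx _ hR (hh x hx _ hR)).trans_lt
      (ENNReal.mul_lt_top ENNReal.ofReal_lt_top measure_ball_lt_top)
  · filter_upwards [hpos] with x hx
    exact Real.rpow_pos_of_pos hx _
  have hess := essInf_distw_nonneg hα hpos P
  have hD : 0 < (n + 1) * P.l := mul_pos (by positivity) P.pos
  set D := (n + 1) * P.l with hD_def
  have hposP : ∀ᵐ x ∂volume.restrict P.set, x ∈ P.set ∧ 0 < infDist x E :=
    (ae_restrict_mem P.measurableSet).and (ae_restrict_of_ae hpos)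
  have : (ae (volume.restrict P.set)).NeBot := ae_restrict_neBot.2 P.volume_set_ne_zero
  obtain ⟨y, hy, hyd⟩ := hposP.exists
  rcases le_or_gt (2 * D) (infDist P.a E) with hfar | hnear
  · set d := infDist P.a E
    have hd : 0 < d := by linarith
    have hlow : ∀ z ∈ P.set, d / 2 ≤ infDist z E := fun z hz => by
      have h1 := P.dist_le P.corner_mem hz
      have h2 : d ≤ infDist z E + dist P.a z := infDist_le_infDist_add_dist
      linarith
    have hup : ∀ z ∈ P.set, infDist z E ≤ 3 * (d / 2) := fun z hz => by
      have h1 := P.dist_le hz P.corner_mem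
      have h2 : infDist z E ≤ d + dist z P.a := infDist_le_infDist_add_dist
      linarith
    calc ⨍ x in P.set, distw E α x ≤ (d / 2) ^ (-α) :=
          setAverage_distw_le (by positivity)
            (distMeasure_le hα P.measurableSet (by positivity) hlow)
      _ = 3 ^ α * (3 * (d / 2)) ^ (-α) := by
          rw [Real.mul_rpow (by norm_num) (by positivity), ← mul_assoc,
            ← Real.rpow_add (by norm_num), add_neg_cancel, Real.rpow_zero, one_mul]
      _ ≤ 3 ^ α * essInf (distw E α) (volume.restrict P.set) := by
          gcongr
          refine le_essInf_distw hα P hy hyd ?_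
          filter_upwards [hposP] with z hz
          exact rpow_le_distw hα hz.2 (hup z hz.1)
      _ ≤ _ := by
          gcongr
          exact le_max_left _ _
  · obtain ⟨x, hx, hxd⟩ := (infDist_lt_iff hne).1 hnear
    have hR : 0 < 6 * D := by positivity
    have hsub : ∀ z ∈ P.set, dist z x < 3 * D := fun z hz => by
      have h1 := P.dist_le hz P.corner_mem
      linarith [dist_triangle z P.a x]
    have h0 := hh x hx _ hR
    have hb := hball x hx _ hR h0
    have hup : ∀ z ∈ P.set, infDist z E ≤ hFree E x (6 * D) := fun z hz => by
      have h1 := hsub z hz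
      have h2 : infDist z E ≤ dist z x := infDist_le_dist_of_mem hx
      exact le_hFree hx (by rw [mem_ball]; linarith) le_rfl (by linarith)
    set h := hFree E x (6 * D)
    calc ⨍ x in P.set, distw E α x ≤ K * h ^ (-α) * ((6 * (n + 1)) ^ n * v) := by
          refine setAverage_distw_le (by positivity) ?_
          calc distMeasure E α P.set ≤ distMeasure E α (ball x (6 * D)) :=
                measure_mono fun z hz => by rw [mem_ball]; linarith [hsub z hz]
            _ ≤ _ := hb
            _ = _ := by
                rw [← ENNReal.ofReal_toReal (measure_ball_lt_top (x := x) (r := 6 * D)).ne,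
                  volume_real_ball x hR, P.volume_set, ← ENNReal.ofReal_mul (by positivity),
                  ← ENNReal.ofReal_mul (by positivity)]
                congr 1
                rw [hD_def, ← hv_def, ← mul_assoc 6, mul_pow _ P.l]
                ring
      _ = K * (6 * (n + 1)) ^ n * v * h ^ (-α) := by ring
      _ ≤ K * (6 * (n + 1)) ^ n * v * essInf (distw E α) (volume.restrict P.set) := by
          gcongr
          refine le_essInf_distw hα P hy hyd ?_
          filter_upwards [hposP] with z hz
          exact rpow_le_distw hα hz.2 (hup z hz.1)
      _ ≤ _ := by
          gcongr
          exact le_max_right _ _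

end

/-- For `α > 0`, `dist(·,E)^{-α} ∈ A₁` if and only if `Mu(E) > α`. -/
theorem a1_iff_lt_muckExp {n : ℕ} (E : Set (EuclideanSpace ℝ (Fin n)))
    (hne : E.Nonempty) (α : ℝ) (hα : 0 < α) :
    MemA1 (distw E α) ↔ α < MuckExp E := by
  constructor
  · intro hw
    have hh : ∀ x ∈ E, ∀ R : ℝ, 0 < R → 0 < hFree E x R := fun x hx R hR =>
      hFree_pos (ae_infDist_pos hα hw.1) hx hR
    obtain ⟨β, hβ, hαβ⟩ := exists_mem_muckSet_of_memA1 hne hα hw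
    obtain ⟨x, hx⟩ := hne
    rw [MuckExp, if_pos hh]
    exact hαβ.trans_le (le_csSup ⟨n, fun γ hγ => le_of_mem_muckSet hx (hh x hx) hγ⟩ hβ)
  · intro h
    rw [MuckExp] at h
    split_ifs at h with hh
    · have hS : (MuckSet E).Nonempty := by
        by_contra hS
        rw [Set.not_nonempty_iff_eq_empty.1 hS, Real.sSup_empty] at h
        linarith
      obtain ⟨β, hβ, hαβ⟩ := exists_lt_of_lt_csSup hS h
      exact memA1_of_mem_muckSet hne hα hh hαβ hβ
    · linarith
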